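/- arXiv:1302.3540 — 3 statements merged into one kernel-verified Lean document; each statement's English description precedes it below -/
import Mathlib

section
/- Let h and m be odd positive integers and let d : ℤ → ℤ be a function satisfying d(α + h) = d(α) and d(−α) = d(α) for all α ∈ ℤ. Then Σ_{α ∈ ℤ, 0 < α < hm/2} α·(α − hm)·d(α) = m · Σ_{l ∈ ℤ, 0 < l < h/2} l·(l − h)·d(l) − h² · (Σ_{l=0}^{h−1} d(l)) · (m³ − m)/12. (Here (m³ − m)/12 is an integer since m is odd; equivalently one may multiply both sides by 12 to state the identity purely over ℤ.) -/
/-- A sum over `0 ≤ α < N`, with `N` odd, of a function that vanishes at `0` and is invariant under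
`α ↦ N - α` is twice its lower half. -/
theorem two_mul_sum_lower_half {N : ℤ} (hN : 0 < N) (hodd : Odd N) {f : ℤ → ℤ}
    (h0 : f 0 = 0) (hf : ∀ α, f (N - α) = f α) :
    2 * ∑ α ∈ (Finset.Ioo (0 : ℤ) N).filter (fun α => 2 * α < N), f α
      = ∑ α ∈ Finset.Ico (0 : ℤ) N, f α := by
  have hupper : ∑ α ∈ (Finset.Ioo (0 : ℤ) N).filter (fun α => ¬ 2 * α < N), f α
      = ∑ α ∈ (Finset.Ioo (0 : ℤ) N).filter (fun α => 2 * α < N), f α := by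
    obtain ⟨k, hk⟩ := hodd
    refine Finset.sum_nbij' (fun α => N - α) (fun α => N - α) ?_ ?_ ?_ ?_ ?_
    · intro α hα
      simp only [Finset.mem_filter, Finset.mem_Ioo] at hα ⊢
      omega
    · intro α hα
      simp only [Finset.mem_filter, Finset.mem_Ioo] at hα ⊢
      omega
    · simp
    · simp
    · simp [hf]
  rw [← Finset.Ioo_insert_left hN, Finset.sum_insert (by simp), h0, zero_add,
    ← Finset.sum_filter_add_sum_filter_not (Finset.Ioo 0 N) (fun α => 2 * α < N), hupper, two_mul]

/-- Sum over `0 ≤ α < h n`, split by writing `α = l + k h` with `0 ≤ l < h` and `0 ≤ k < n`. -/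
theorem sum_Ico_mul {h : ℤ} (hpos : 0 < h) (g : ℤ → ℤ) (n : ℕ) :
    ∑ α ∈ Finset.Ico (0 : ℤ) (h * n), g α
      = ∑ l ∈ Finset.Ico (0 : ℤ) h, ∑ k ∈ Finset.range n, g (l + k * h) := by
  induction n with
  | zero => simp
  | succ n ih =>
    have hblock : ∑ α ∈ Finset.Ico (h * n) (h * (n + 1 : ℕ)), g α
        = ∑ l ∈ Finset.Ico (0 : ℤ) h, g (l + n * h) := by
      symm
      refine Finset.sum_nbij' (fun l => l + n * h) (fun α => α - n * h) ?_ ?_ ?_ ?_ ?_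
      · intro l hl
        simp only [Finset.mem_Ico] at hl ⊢
        push_cast
        constructor <;> linarith
      · intro α hα
        simp only [Finset.mem_Ico] at hα ⊢
        push_cast at hα
        constructor <;> linarith
      · simp
      · simp
      · simp
    have hle : h * (n : ℤ) ≤ h * (n + 1 : ℕ) := by push_cast; linarith
    simp only [Finset.sum_range_succ, Finset.sum_add_distrib]
    rw [← ih, ← hblock, ← Finset.Ico_union_Ico_eq_Ico (by positivity) hle,
      Finset.sum_union (Finset.Ico_disjoint_Ico_consecutive _ _ _)]

theorem six_mul_sum_range_quadratic (h l N : ℤ) (n : ℕ) :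
    6 * ∑ k ∈ Finset.range n, (l + k * h) * (l + k * h - N)
      = 6 * n * l * (l - N) + 3 * h * n * (n - 1) * (2 * l - N)
        + h ^ 2 * n * (n - 1) * (2 * n - 1) := by
  induction n with
  | zero => simp
  | succ n ih =>
    rw [Finset.sum_range_succ, mul_add, ih]
    push_cast
    ring


/-- **Summation identity for the Sugawara anomaly.**
Let `h` and `m` be odd positive integers and `d : ℤ → ℤ` an `h`-periodic even function.
Then `Σ_{0 < α < hm/2} α (α − hm) d α = m Σ_{0 < l < h/2} l (l − h) d l
  − h² (Σ_{l=0}^{h−1} d l) (m³ − m)/12`, stated multiplied through by 12 over `ℤ`. -/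
theorem sugawara_anomaly_sum (h m : ℤ) (hpos : 0 < h) (mpos : 0 < m)
    (hodd : Odd h) (modd : Odd m) (d : ℤ → ℤ)
    (hper : ∀ α : ℤ, d (α + h) = d α) (heven : ∀ α : ℤ, d (-α) = d α) :
    12 * ∑ α ∈ (Finset.Ioo (0 : ℤ) (h * m)).filter (fun α => 2 * α < h * m),
        α * (α - h * m) * d α
      = 12 * (m * ∑ l ∈ (Finset.Ioo (0 : ℤ) h).filter (fun l => 2 * l < h),
            l * (l - h) * d l)
        - h ^ 2 * (∑ l ∈ Finset.Ico (0 : ℤ) h, d l) * (m ^ 3 - m) := by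
  have hrefl (N : ℤ) (hN : ∀ α, d (α + N) = d α) (α : ℤ) :
      (N - α) * (N - α - N) * d (N - α) = α * (α - N) * d α := by
    rw [show N - α = -α + N by ring, hN, heven]
    ring
  have hmul (k : ℤ) (α : ℤ) : d (α + k * h) = d α := by
    simpa using (show Function.Periodic d h from hper).int_mul k α
  have hS := two_mul_sum_lower_half (mul_pos hpos mpos) (hodd.mul modd)
    (f := fun α => α * (α - h * m) * d α) (by simp)
    (hrefl (h * m) fun α => by rw [mul_comm h m, hmul])
  have hT := two_mul_sum_lower_half hpos hodd
    (f := fun l => l * (l - h) * d l) (by simp) (hrefl h hper)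
  have hfull : 6 * ∑ α ∈ Finset.Ico (0 : ℤ) (h * m), α * (α - h * m) * d α
      = 6 * (m * ∑ l ∈ Finset.Ico (0 : ℤ) h, l * (l - h) * d l)
        - h ^ 2 * (∑ l ∈ Finset.Ico (0 : ℤ) h, d l) * (m ^ 3 - m) := by
    lift m to ℕ using mpos.le
    rw [sum_Ico_mul hpos, Finset.mul_sum, Finset.mul_sum, Finset.mul_sum, Finset.mul_sum,
      Finset.sum_mul, ← Finset.sum_sub_distrib]
    refine Finset.sum_congr rfl fun l _ => ?_
    simp only [hmul]
    rw [← Finset.sum_mul, ← mul_assoc, six_mul_sum_range_quadratic]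
    ring
  rw [← hS, ← hT] at hfull
  linarith
end

section
/- With the operators Lₙ of the rank-one untwisted Sugawara construction on the bosonic Fock space R = ℂ[t₁, t₂, t₃, …], one has the Virasoro commutation relations [Lₙ, Lₘ] = (n − m)·L_{n+m} + δ_{n,−m}·((n³ − n)/12)·id_R for all n, m ∈ ℤ. -/
open scoped BigOperators

/-- The bosonic Fock space `R = ℂ[t₁, t₂, t₃, …]`, a polynomial ring in countably many
variables indexed by the positive natural numbers. -/
abbrev FockSpace : Type := MvPolynomial ℕ+ ℂ

/-- The Heisenberg operators: for `n > 0`, `a n = n·∂/∂tₙ` and `a (−n)` is multiplication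
by `tₙ`; `a 0 = 0`. -/
noncomputable def heisOp (i : ℤ) : Module.End ℂ FockSpace :=
  if hpos : 0 < i then
    (i : ℂ) • (MvPolynomial.pderiv (⟨i.toNat, by omega⟩ : ℕ+)).toLinearMap
  else if hneg : i < 0 then
    LinearMap.mulLeft ℂ (MvPolynomial.X (⟨(-i).toNat, by omega⟩ : ℕ+))
  else 0

/-- Normally ordered product `:aᵢaⱼ:`, the factor with the smaller (possibly negative)
index placed on the left. -/
noncomputable def normalOrd (i j : ℤ) : Module.End ℂ FockSpace :=
  heisOp (min i j) * heisOp (max i j)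

/-- The Sugawara operator `Lₙ = (1/2)·Σ_{i+j=n} :aᵢaⱼ:`; applied to any fixed polynomial
only finitely many summands are nonzero, so the sum is a well-defined finite sum
(formalized with `finsum`). -/
noncomputable def sugawaraOp (n : ℤ) : FockSpace → FockSpace :=
  fun p => (2 : ℂ)⁻¹ • ∑ᶠ i : ℤ, normalOrd i (n - i) p

open MvPolynomial

theorem heisOp_zero : heisOp 0 = 0 := by simp [heisOp]

theorem heisOp_pos_apply (k : ℕ+) (p : FockSpace) :
    heisOp (k : ℕ) p = ((k : ℕ) : ℂ) • pderiv k p := by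
  have h : (0 : ℤ) < (k : ℕ) := by exact_mod_cast k.pos
  rw [heisOp, dif_pos h]
  rfl

theorem heisOp_neg_apply (k : ℕ+) (p : FockSpace) : heisOp (-(k : ℕ)) p = X k * p := by
  have h : (0 : ℤ) < (k : ℕ) := by exact_mod_cast k.pos
  rw [heisOp, dif_neg (by omega), dif_pos (by omega), LinearMap.mulLeft_apply]
  congr 2
  exact PNat.eq (by simp)

theorem exists_pnat_cases (i : ℤ) :
    i = 0 ∨ (∃ k : ℕ+, i = (k : ℕ)) ∨ ∃ k : ℕ+, i = -((k : ℕ) : ℤ) := by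
  rcases lt_trichotomy i 0 with h | h | h
  · exact .inr (.inr ⟨⟨(-i).toNat, by omega⟩, by simp; omega⟩)
  · exact .inl h
  · exact .inr (.inl ⟨⟨i.toNat, by omega⟩, by simp; omega⟩)

theorem pderiv_comm (i j : ℕ+) (p : FockSpace) :
    pderiv i (pderiv j p) = pderiv j (pderiv i p) := by
  have h : ⁅(pderiv i : Derivation ℂ FockSpace FockSpace), pderiv j⁆ = 0 :=
    derivation_ext fun l => by
      classical
      rw [Derivation.commutator_apply, pderiv_X, pderiv_X, Pi.single_apply, Pi.single_apply]
      split_ifs <;> simp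
  have := congrArg (fun D : Derivation ℂ FockSpace FockSpace => D p) h
  rwa [Derivation.commutator_apply, Derivation.zero_apply, sub_eq_zero] at this

/-- The Heisenberg relations. -/
theorem heisOp_commutator (i j : ℤ) :
    heisOp i * heisOp j - heisOp j * heisOp i = (if i = -j then (i : ℂ) else 0) • 1 := by
  refine LinearMap.ext fun p => ?_
  simp only [LinearMap.sub_apply, Module.End.mul_apply, LinearMap.smul_apply, Module.End.one_apply]
  rcases exists_pnat_cases i with rfl | ⟨k, rfl⟩ | ⟨k, rfl⟩
  · simp [heisOp_zero]
  all_goals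
    have hk := k.pos
    rcases exists_pnat_cases j with rfl | ⟨l, rfl⟩ | ⟨l, rfl⟩
    · simp [heisOp_zero]
    all_goals have hl := l.pos
  · rw [if_neg (by omega)]
    simp only [heisOp_pos_apply, map_smul]
    rw [pderiv_comm k l, smul_comm, sub_self, zero_smul]
  · by_cases h : k = l
    · subst h
      simp [heisOp_pos_apply, heisOp_neg_apply]
    · have h' : (k : ℕ) ≠ l := fun e => h (PNat.eq e)
      rw [if_neg (by omega)]
      simp [heisOp_pos_apply, heisOp_neg_apply, pderiv_X_of_ne (Ne.symm h)]
  · by_cases h : l = k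
    · subst h
      simp [heisOp_pos_apply, heisOp_neg_apply]
    · have h' : (k : ℕ) ≠ l := fun e => h (PNat.eq e.symm)
      rw [if_neg (by omega)]
      simp [heisOp_pos_apply, heisOp_neg_apply, pderiv_X_of_ne (Ne.symm h)]
  · rw [if_neg (by omega)]
    simp [heisOp_neg_apply, mul_left_comm]

/-- Every polynomial is annihilated by all `heisOp i` with `i` large. -/
theorem exists_forall_heisOp_eq_zero (p : FockSpace) : ∃ N : ℤ, ∀ i > N, heisOp i p = 0 := by
  obtain ⟨M, hM⟩ := p.vars.bddAbove
  refine ⟨(M : ℕ), fun i hi => ?_⟩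
  rcases exists_pnat_cases i with rfl | ⟨k, rfl⟩ | ⟨k, rfl⟩
  · simp [heisOp_zero]
  · rw [heisOp_pos_apply, pderiv_eq_zero_of_notMem_vars, smul_zero]
    intro hk
    have : (k : ℕ) ≤ M := hM hk
    omega
  · omega

theorem hasFiniteSupport_normalOrd (n : ℤ) (p : FockSpace) :
    (fun i : ℤ => normalOrd i (n - i) p).HasFiniteSupport := by
  obtain ⟨N, hN⟩ := exists_forall_heisOp_eq_zero p
  refine (Set.finite_Icc (n - N) N).subset fun i hi => ?_
  by_contra h
  refine hi ?_
  have : N < max i (n - i) := by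
    rw [Set.mem_Icc] at h
    rw [lt_max_iff]
    omega
  simp [normalOrd, hN _ this]

/-- The Sugawara operator as a linear map. -/
noncomputable def sugawaraLin (n : ℤ) : Module.End ℂ FockSpace where
  toFun := sugawaraOp n
  map_add' p q := by
    simp only [sugawaraOp, map_add]
    rw [finsum_add_distrib (hasFiniteSupport_normalOrd n p) (hasFiniteSupport_normalOrd n q),
      smul_add]
  map_smul' c p := by
    simp only [sugawaraOp, map_smul, RingHom.id_apply]
    rw [← smul_finsum' c (hasFiniteSupport_normalOrd n p), smul_comm]

theorem sugawaraLin_apply (n : ℤ) (p : FockSpace) :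
    sugawaraLin n p = (2 : ℂ)⁻¹ • ∑ᶠ i : ℤ, normalOrd i (n - i) p := rfl

theorem map_sugawaraLin {V : Type*} [AddCommGroup V] [Module ℂ V] (T : FockSpace →ₗ[ℂ] V)
    (n : ℤ) (p : FockSpace) :
    T (sugawaraLin n p) = (2 : ℂ)⁻¹ • ∑ᶠ i : ℤ, T (normalOrd i (n - i) p) := by
  rw [sugawaraLin_apply, map_smul]
  congr 1
  exact T.toAddMonoidHom.map_finsum (hasFiniteSupport_normalOrd n p)

theorem normalOrd_commutator (i j k : ℤ) :
    normalOrd i j * heisOp k - heisOp k * normalOrd i j =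
      (if j = -k then (j : ℂ) else 0) • heisOp i + (if i = -k then (i : ℂ) else 0) • heisOp j := by
  have key (i j : ℤ) : heisOp i * heisOp j * heisOp k - heisOp k * (heisOp i * heisOp j) =
      (if j = -k then (j : ℂ) else 0) • heisOp i +
        (if i = -k then (i : ℂ) else 0) • heisOp j := by
    have : heisOp i * heisOp j * heisOp k - heisOp k * (heisOp i * heisOp j) =
        heisOp i * (heisOp j * heisOp k - heisOp k * heisOp j) +
          (heisOp i * heisOp k - heisOp k * heisOp i) * heisOp j := by
      rw [mul_sub, sub_mul]
      simp only [mul_assoc]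
      abel
    rw [this, heisOp_commutator, heisOp_commutator, mul_smul_comm, smul_mul_assoc, mul_one, one_mul]
  rcases le_total i j with h | h
  · rw [normalOrd, min_eq_left h, max_eq_right h, key]
  · rw [normalOrd, min_eq_right h, max_eq_left h, key, add_comm]

theorem sugawaraLin_heisOp_commutator (n k : ℤ) :
    ⁅sugawaraLin n, heisOp k⁆ = (-k : ℂ) • heisOp (n + k) := by
  rw [Ring.lie_def]
  refine LinearMap.ext fun p => ?_
  have hfin : (fun i : ℤ => heisOp k (normalOrd i (n - i) p)).HasFiniteSupport :=
    (hasFiniteSupport_normalOrd n p).subset fun i hi h0 => hi (by simp_all)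
  simp only [LinearMap.sub_apply, Module.End.mul_apply, LinearMap.smul_apply]
  rw [map_sugawaraLin, sugawaraLin_apply, ← smul_sub,
    ← finsum_sub_distrib (hasFiniteSupport_normalOrd n _) hfin]
  have hterm (i : ℤ) : normalOrd i (n - i) (heisOp k p) - heisOp k (normalOrd i (n - i) p) =
      (if n - i = -k then ((n - i : ℤ) : ℂ) else 0) • heisOp i p +
        (if i = -k then (i : ℂ) else 0) • heisOp (n - i) p :=
    congrArg (fun T : Module.End ℂ FockSpace => T p) (normalOrd_commutator i (n - i) k)
  have h₁ (i : ℤ) (hi : i ≠ n + k) :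
      (if n - i = -k then ((n - i : ℤ) : ℂ) else 0) • heisOp i p = 0 := by
    rw [if_neg (by omega), zero_smul]
  have h₂ (i : ℤ) (hi : i ≠ -k) : (if i = -k then (i : ℂ) else 0) • heisOp (n - i) p = 0 := by
    rw [if_neg hi, zero_smul]
  simp_rw [hterm]
  rw [finsum_add_distrib
      ((Set.finite_singleton (n + k)).subset fun i hi => by_contra fun h => hi (h₁ i h))
      ((Set.finite_singleton (-k)).subset fun i hi => by_contra fun h => hi (h₂ i h)),
    finsum_eq_single _ _ h₁, finsum_eq_single _ _ h₂, if_pos (by omega), if_pos rfl,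
    sub_neg_eq_add, ← add_smul, smul_smul]
  congr 1
  push_cast
  ring

/-- An operator commuting with all multiplications by variables is a multiplication operator. -/
theorem apply_eq_mul_apply_one {T : Module.End ℂ FockSpace}
    (hT : ∀ (k : ℕ+) (p : FockSpace), T (X k * p) = X k * T p) (p : FockSpace) :
    T p = p * T 1 := by
  induction p using MvPolynomial.induction_on with
  | C a => rw [← mul_one (C a), ← smul_eq_C_mul, map_smul, smul_mul_assoc, one_mul]
  | add p q hp hq => rw [map_add, hp, hq, add_mul]
  | mul_X p k hp => rw [mul_comm p, hT, hp, mul_assoc]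

theorem eq_C_of_forall_pderiv_eq_zero {p : FockSpace} (hp : ∀ k : ℕ+, pderiv k p = 0) :
    p = C (constantCoeff p) := by
  classical
  ext m
  rw [coeff_C]
  split_ifs with h
  · rw [← h, constantCoeff_eq]
  · obtain ⟨k, hk⟩ := Finsupp.ne_iff.mp (Ne.symm h)
    have hle : Finsupp.single k 1 ≤ m := by
      rw [Finsupp.single_le_iff]
      exact Nat.one_le_iff_ne_zero.mpr hk
    have h0 := coeff_pderiv (i := k) p (m - Finsupp.single k 1)
    rw [hp, coeff_zero, tsub_add_cancel_of_le hle] at h0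
    exact (mul_eq_zero.mp h0.symm).resolve_right (Nat.cast_add_one_ne_zero _)

/-- Schur's lemma for the Fock space. -/
theorem eq_smul_one_of_commute_heisOp {T : Module.End ℂ FockSpace}
    (hT : ∀ k : ℤ, Commute T (heisOp k)) : T = constantCoeff (T 1) • 1 := by
  have hcomm (k : ℤ) (p : FockSpace) : T (heisOp k p) = heisOp k (T p) :=
    congrArg (fun S : Module.End ℂ FockSpace => S p) (hT k)
  have h1 : T 1 = C (constantCoeff (T 1)) := by
    refine eq_C_of_forall_pderiv_eq_zero fun k => ?_
    have := hcomm (k : ℕ) 1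
    rw [heisOp_pos_apply, heisOp_pos_apply, pderiv_one, smul_zero, map_zero] at this
    exact (smul_eq_zero.mp this.symm).resolve_left (by exact_mod_cast k.ne_zero)
  refine LinearMap.ext fun p => ?_
  rw [apply_eq_mul_apply_one (fun k p => by simpa only [heisOp_neg_apply] using hcomm (-(k : ℕ)) p),
    LinearMap.smul_apply, Module.End.one_apply, smul_eq_C_mul, mul_comm, ← h1]

theorem constantCoeff_heisOp {i : ℤ} (hi : i ≤ 0) (p : FockSpace) :
    constantCoeff (heisOp i p) = 0 := by
  rcases exists_pnat_cases i with rfl | ⟨k, rfl⟩ | ⟨k, rfl⟩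
  · simp [heisOp_zero]
  · have := k.pos
    omega
  · simp [heisOp_neg_apply]

theorem heisOp_one {i : ℤ} (hi : 0 ≤ i) : heisOp i 1 = 0 := by
  rcases exists_pnat_cases i with rfl | ⟨k, rfl⟩ | ⟨k, rfl⟩
  · simp [heisOp_zero]
  · simp [heisOp_pos_apply]
  · have := k.pos
    omega

theorem constantCoeff_sugawaraLin {n : ℤ} (hn : n ≤ 0) (p : FockSpace) :
    constantCoeff (sugawaraLin n p) = 0 := by
  have h := map_sugawaraLin (lcoeff ℂ 0) n p
  have h0 (i : ℤ) : lcoeff ℂ 0 (normalOrd i (n - i) p) = 0 :=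
    constantCoeff_heisOp (by rw [min_le_iff]; omega) _
  simp only [h0, finsum_zero, smul_zero] at h
  exact h

theorem sugawaraLin_one {n : ℤ} (hn : 0 ≤ n) : sugawaraLin n 1 = 0 := by
  have h0 (i : ℤ) : normalOrd i (n - i) 1 = 0 := by
    rw [normalOrd, Module.End.mul_apply, heisOp_one (by rw [le_max_iff]; omega), map_zero]
  simp [sugawaraLin_apply, h0]

theorem constantCoeff_heisOp_heisOp_one (i : ℤ) {j : ℤ} (hj : j < 0) :
    constantCoeff (heisOp i (heisOp j 1)) = if i = -j then (i : ℂ) else 0 := by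
  have h := congrArg (fun T : Module.End ℂ FockSpace => constantCoeff (T 1)) (heisOp_commutator i j)
  simpa only [LinearMap.sub_apply, Module.End.mul_apply, LinearMap.smul_apply, Module.End.one_apply,
    map_sub, constantCoeff_heisOp hj.le, sub_zero, constantCoeff_smul, map_one, smul_eq_mul,
    mul_one] using h

theorem constantCoeff_sugawaraLin_normalOrd_one (n i j : ℤ) :
    constantCoeff (sugawaraLin n (normalOrd i j 1)) =
      if i < 0 ∧ j < 0 ∧ n = -(i + j) then (i * j : ℂ) else 0 := by
  wlog hij : i ≤ j generalizing i j
  · have hsymm : normalOrd i j = normalOrd j i := by rw [normalOrd, normalOrd, min_comm, max_comm]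
    rw [hsymm, this j i (le_of_not_ge hij), mul_comm, add_comm j i]
    simp only [and_left_comm]
  rw [normalOrd, min_eq_left hij, max_eq_right hij, Module.End.mul_apply]
  by_cases hj : j < 0
  · have h := congrArg (fun T : Module.End ℂ FockSpace => constantCoeff (T (heisOp j 1)))
      (sugawaraLin_heisOp_commutator n i)
    simp only [Ring.lie_def, LinearMap.sub_apply, Module.End.mul_apply, LinearMap.smul_apply,
      map_sub, constantCoeff_heisOp (hij.trans hj.le), sub_zero, smul_eq_C_mul, map_mul,
      constantCoeff_C, constantCoeff_heisOp_heisOp_one _ hj] at h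
    rw [h]
    by_cases hn : n = -(i + j)
    · rw [if_pos (by omega), if_pos (by omega), hn]
      push_cast
      ring
    · rw [if_neg (by omega), if_neg (by omega), mul_zero]
  · rw [heisOp_one (not_lt.mp hj), if_neg (by omega)]
    simp

theorem sum_range_mul_sub (x : ℂ) (N : ℕ) :
    ∑ i ∈ Finset.range N, (i : ℂ) * (x - i) =
      x * (N * (N - 1) / 2) - (N - 1) * N * (2 * N - 1) / 6 := by
  induction N with
  | zero => simp
  | succ N ih =>
    rw [Finset.sum_range_succ, ih]
    push_cast
    ring

/-- The vacuum expectation value of `Lₙ Lₘ`. -/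
theorem constantCoeff_sugawaraLin_sugawaraLin_one (n m : ℤ) :
    constantCoeff (sugawaraLin n (sugawaraLin m 1)) =
      if n = -m ∧ 0 ≤ n then ((n : ℂ) ^ 3 - n) / 12 else 0 := by
  have h := map_sugawaraLin (lcoeff ℂ 0 ∘ₗ sugawaraLin n) m 1
  have hterm (i : ℤ) : (lcoeff ℂ 0 ∘ₗ sugawaraLin n) (normalOrd i (m - i) 1) =
      if i < 0 ∧ m - i < 0 ∧ n = -(i + (m - i)) then (i * ((m - i : ℤ) : ℂ)) else 0 :=
    constantCoeff_sugawaraLin_normalOrd_one n i (m - i)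
  simp only [hterm] at h
  refine Eq.trans h ?_
  split_ifs with hn
  · obtain ⟨rfl, hn⟩ := hn
    obtain ⟨N, hN⟩ := Int.eq_ofNat_of_zero_le hn
    obtain rfl : m = -N := by omega
    have hinj : Function.Injective fun i : ℕ => -(i : ℤ) := fun a b hab => by
      simpa using hab
    rw [finsum_eq_sum_of_support_subset (s := (Finset.range N).map ⟨_, hinj⟩), Finset.sum_map,
      Finset.sum_congr rfl (g := fun i : ℕ => (i : ℂ) * (N - i)), sum_range_mul_sub]
    · simp only [neg_neg, Int.cast_natCast, smul_eq_mul]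
      ring
    · intro i hi
      rw [Finset.mem_range] at hi
      rcases Nat.eq_zero_or_pos i with rfl | h0
      · simp
      · simp only [Function.Embedding.coeFn_mk]
        rw [if_pos (by omega)]
        push_cast
        ring
    · intro i hi
      have hi' := (ite_ne_right_iff.mp hi).1
      simp only [Finset.coe_map, Function.Embedding.coeFn_mk, Set.mem_image, Finset.mem_coe,
        Finset.mem_range]
      exact ⟨(-i).toNat, by omega, by omega⟩
  · have h0 (i : ℤ) : ¬(i < 0 ∧ m - i < 0 ∧ n = -(i + (m - i))) := by omega
    simp only [h0, if_false, finsum_zero, smul_zero]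

theorem constantCoeff_sugawaraLin_one (n : ℤ) : constantCoeff (sugawaraLin n 1) = 0 := by
  rcases le_total n 0 with hn | hn
  · exact constantCoeff_sugawaraLin hn 1
  · rw [sugawaraLin_one hn, map_zero]

theorem sugawaraLin_commutator (n m : ℤ) :
    ⁅sugawaraLin n, sugawaraLin m⁆ = ((n : ℂ) - m) • sugawaraLin (n + m) +
      (if n = -m then ((n : ℂ) ^ 3 - n) / 12 else 0) • 1 := by
  have hcomm (k : ℤ) : Commute
      (⁅sugawaraLin n, sugawaraLin m⁆ - ((n : ℂ) - m) • sugawaraLin (n + m)) (heisOp k) := by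
    have hjacobi : ⁅⁅sugawaraLin n, sugawaraLin m⁆, heisOp k⁆ =
        ⁅sugawaraLin n, ⁅sugawaraLin m, heisOp k⁆⁆ -
          ⁅sugawaraLin m, ⁅sugawaraLin n, heisOp k⁆⁆ := by
      simp only [Ring.lie_def, mul_sub, sub_mul, mul_assoc]
      abel
    have hsmul (l : ℤ) (c : ℂ) (T : Module.End ℂ FockSpace) :
        ⁅sugawaraLin l, c • T⁆ = c • ⁅sugawaraLin l, T⁆ := by
      simp only [Ring.lie_def, mul_smul_comm, smul_mul_assoc, smul_sub]
    rw [commute_iff_eq, ← sub_eq_zero, sub_mul, mul_sub, sub_sub_sub_comm, ← Ring.lie_def, hjacobi,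
      smul_mul_assoc, mul_smul_comm,
      ← smul_sub ((n : ℂ) - m) (sugawaraLin (n + m) * heisOp k), ← Ring.lie_def]
    simp only [sugawaraLin_heisOp_commutator, hsmul]
    rw [← add_assoc, ← add_assoc, add_comm m n]
    push_cast
    module
  have h := eq_smul_one_of_commute_heisOp hcomm
  rw [sub_eq_iff_eq_add'] at h
  rw [h]
  congr 2
  simp only [Ring.lie_def, LinearMap.sub_apply, Module.End.mul_apply, LinearMap.smul_apply,
    map_sub, constantCoeff_smul, constantCoeff_sugawaraLin_one, smul_zero, sub_zero,
    constantCoeff_sugawaraLin_sugawaraLin_one]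
  by_cases hn : n = -m
  · subst hn
    rcases lt_trichotomy m 0 with hm | rfl | hm
    · rw [if_pos (by omega), if_neg (by omega), if_pos rfl, sub_zero]
    · simp
    · rw [if_neg (by omega), if_pos (by omega), if_pos rfl]
      push_cast
      ring
  · rw [if_neg (by omega), if_neg (by omega), if_neg hn, sub_zero]

/-- **Virasoro commutation relations for the rank-one untwisted Sugawara construction:**
`[Lₙ, Lₘ] = (n − m)·L_{n+m} + δ_{n,−m}·((n³ − n)/12)·id`. -/
theorem sugawara_virasoro_relations (n m : ℤ) (p : FockSpace) :
    sugawaraOp n (sugawaraOp m p) - sugawaraOp m (sugawaraOp n p)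
      = ((n : ℂ) - (m : ℂ)) • sugawaraOp (n + m) p
        + (if n = -m then ((n : ℂ) ^ 3 - (n : ℂ)) / 12 else 0) • p := by
  exact congrArg (fun T : Module.End ℂ FockSpace => T p) (sugawaraLin_commutator n m)
end

section
/- With the operators Lₙ of the rank-one h = 2 twisted Sugawara construction on the twisted bosonic Fock space R = ℂ[t₁, t₃, t₅, …], one has the Virasoro commutation relations [Lₙ, Lₘ] = (n − m)·L_{n+m} + δ_{n,−m}·((n³ − n)/12)·id_R for all n, m ∈ ℤ. -/
open scoped BigOperators

/-- The index set of the variables: the positive odd integers. -/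
abbrev OddIdx : Type := {j : ℤ // 0 < j ∧ Odd j}

/-- The twisted bosonic Fock space `R = ℂ[t₁, t₃, t₅, …]`, a polynomial ring in
variables indexed by the positive odd integers. -/
abbrev TwFockSpace : Type := MvPolynomial OddIdx ℂ

/-- The twisted Heisenberg operators: for odd `j > 0`, `a j = (j/2)·∂/∂tⱼ` and `a (−j)` is
multiplication by `tⱼ`; the operator is zero for even indices. -/
noncomputable def twHeisOp (j : ℤ) : Module.End ℂ TwFockSpace :=
  if hodd : Odd j then
    if hpos : 0 < j then
      ((j : ℂ) / 2) • (MvPolynomial.pderiv (⟨j, hpos, hodd⟩ : OddIdx)).toLinearMap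
    else
      LinearMap.mulLeft ℂ (MvPolynomial.X
        (⟨-j, by rcases hodd with ⟨k, hk⟩; omega, hodd.neg⟩ : OddIdx))
  else 0

/-- Normally ordered product `:aᵢaⱼ:`, the factor with the smaller (possibly negative)
index placed on the left. -/
noncomputable def twNormalOrd (i j : ℤ) : Module.End ℂ TwFockSpace :=
  twHeisOp (min i j) * twHeisOp (max i j)

/-- The twisted Sugawara operator
`Lₙ = (1/2)·Σ_{i+j=2n, i,j odd} :aᵢaⱼ: + δ_{n,0}·(1/16)·id`; applied to any fixed
polynomial only finitely many summands are nonzero, so the sum is a well-defined finite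
sum (formalized with `finsum`; the summands with even index vanish by definition). -/
noncomputable def twSugawaraOp (n : ℤ) : TwFockSpace → TwFockSpace :=
  fun p => (2 : ℂ)⁻¹ • ∑ᶠ i : ℤ, twNormalOrd i (2 * n - i) p
    + (if n = 0 then ((16 : ℂ)⁻¹ • p) else 0)

open MvPolynomial

attribute [local instance] LieRing.ofAssociativeRing

lemma lie_smul_end (c : ℂ) (a b : Module.End ℂ TwFockSpace) : ⁅a, c • b⁆ = c • ⁅a, b⁆ := by
  rw [Ring.lie_def, Ring.lie_def, mul_smul_comm, smul_mul_assoc, smul_sub]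

lemma smul_lie_end (c : ℂ) (a b : Module.End ℂ TwFockSpace) : ⁅c • a, b⁆ = c • ⁅a, b⁆ := by
  rw [Ring.lie_def, Ring.lie_def, mul_smul_comm, smul_mul_assoc, smul_sub]

lemma MvPolynomial.pderiv_pderiv_comm {σ R : Type*} [CommRing R] (i j : σ)
    (p : MvPolynomial σ R) : pderiv i (pderiv j p) = pderiv j (pderiv i p) := by
  classical
  have h : ⁅pderiv (R := R) i, pderiv (R := R) j⁆ = 0 := by
    refine MvPolynomial.derivation_ext fun k => ?_
    simp only [Derivation.commutator_apply, pderiv_X, Pi.single_apply]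
    split_ifs <;> simp
  have h' := Derivation.congr_fun h p
  rwa [Derivation.commutator_apply, Derivation.zero_apply, sub_eq_zero] at h'

lemma twHeisOp_of_not_odd {j : ℤ} (h : ¬ Odd j) : twHeisOp j = 0 := by
  simp [twHeisOp, h]

lemma twHeisOp_pos_apply {j : ℤ} (hpos : 0 < j) (hodd : Odd j) (p : TwFockSpace) :
    twHeisOp j p = ((j : ℂ) / 2) • pderiv (⟨j, hpos, hodd⟩ : OddIdx) p := by
  simp [twHeisOp, hodd, hpos]

lemma twHeisOp_neg_apply (j : OddIdx) (p : TwFockSpace) :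
    twHeisOp (-j.1) p = X j * p := by
  obtain ⟨j, hpos, hodd⟩ := j
  simp [twHeisOp, hodd, hpos.le.not_gt]

lemma exists_oddIdx_eq_neg {j : ℤ} (hodd : Odd j) (hj : j ≤ 0) :
    ∃ k : OddIdx, j = -k.1 := by
  refine ⟨⟨-j, ?_, hodd.neg⟩, (neg_neg j).symm⟩
  obtain ⟨k, rfl⟩ := hodd
  omega

lemma twHeisOp_pos_one {j : ℤ} (hpos : 0 < j) : twHeisOp j (1 : TwFockSpace) = 0 := by
  by_cases hodd : Odd j
  · rw [twHeisOp_pos_apply hpos hodd, pderiv_one, smul_zero]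
  · simp [twHeisOp_of_not_odd hodd]

lemma constantCoeff_twHeisOp_of_nonpos {j : ℤ} (hj : j ≤ 0) (p : TwFockSpace) :
    constantCoeff (twHeisOp j p) = 0 := by
  by_cases hodd : Odd j
  · obtain ⟨k, rfl⟩ := exists_oddIdx_eq_neg hodd hj
    simp [twHeisOp_neg_apply]
  · simp [twHeisOp_of_not_odd hodd]

/-- The twisted Heisenberg relations, in applied form. -/
lemma twHeisOp_comm_apply (i j : ℤ) (p : TwFockSpace) :
    twHeisOp i (twHeisOp j p) - twHeisOp j (twHeisOp i p)
      = (if i = -j ∧ Odd i then (i : ℂ) / 2 else 0) • p := by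
  have hpn (i : ℤ) (k : OddIdx) (hi : 0 < i) (hio : Odd i) :
      twHeisOp i (twHeisOp (-k.1) p) - twHeisOp (-k.1) (twHeisOp i p)
        = (if i = k.1 then (i : ℂ) / 2 else 0) • p := by
    simp only [twHeisOp_pos_apply hi hio, twHeisOp_neg_apply, pderiv_mul, mul_smul_comm]
    rw [← smul_sub, add_sub_cancel_right]
    by_cases h : i = k.1
    · have hk : k = ⟨i, hi, hio⟩ := Subtype.ext h.symm
      rw [if_pos h, hk, pderiv_X_self, one_mul]
    · have hk : k ≠ ⟨i, hi, hio⟩ := fun h' => h (congrArg Subtype.val h').symm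
      rw [if_neg h, pderiv_X_of_ne hk, zero_mul, smul_zero, zero_smul]
  by_cases hio : Odd i
  swap
  · simp [twHeisOp_of_not_odd hio, hio]
  by_cases hjo : Odd j
  swap
  · have : ¬ (i = -j ∧ Odd i) := by
      rintro ⟨rfl, h⟩
      exact hjo (by simpa using h.neg)
    simp [twHeisOp_of_not_odd hjo, this]
  rcases lt_or_ge 0 i with hi | hi <;> rcases lt_or_ge 0 j with hj | hj
  · rw [if_neg (by omega), zero_smul, sub_eq_zero]
    rw [twHeisOp_pos_apply hi hio, twHeisOp_pos_apply hj hjo, twHeisOp_pos_apply hj hjo,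
      twHeisOp_pos_apply hi hio, Derivation.map_smul, Derivation.map_smul, smul_comm,
      pderiv_pderiv_comm]
  · obtain ⟨k, rfl⟩ := exists_oddIdx_eq_neg hjo hj
    rw [hpn i k hi hio]
    simp [hio]
  · obtain ⟨k, rfl⟩ := exists_oddIdx_eq_neg hio hi
    rw [← neg_sub, hpn j k hj hjo, ← neg_smul]
    congr 1
    by_cases h : j = k.1
    · simp [h, k.2.2, neg_div]
    · rw [if_neg h, if_neg (by omega), neg_zero]
  · rw [if_neg (by obtain ⟨k, rfl⟩ := hio; omega), zero_smul, sub_eq_zero]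
    obtain ⟨k, rfl⟩ := exists_oddIdx_eq_neg hio hi
    obtain ⟨l, rfl⟩ := exists_oddIdx_eq_neg hjo hj
    simp only [twHeisOp_neg_apply, mul_left_comm]

lemma twHeisOp_comm (i j : ℤ) :
    twHeisOp i * twHeisOp j = twHeisOp j * twHeisOp i
      + (if i = -j ∧ Odd i then (i : ℂ) / 2 else 0) • 1 := by
  refine LinearMap.ext fun p => ?_
  exact sub_eq_iff_eq_add'.1 (twHeisOp_comm_apply i j p)

/-- Each polynomial is annihilated by all annihilation operators of large enough index. -/
lemma exists_twHeisOp_eq_zero (p : TwFockSpace) :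
    ∃ B : ℤ, ∀ j, B < j → twHeisOp j p = 0 := by
  classical
  obtain ⟨B, hB⟩ := (p.vars.image Subtype.val).bddAbove
  refine ⟨max B 0, fun j hj => ?_⟩
  by_cases hodd : Odd j
  · have hpos : 0 < j := (le_max_right B 0).trans_lt hj
    rw [twHeisOp_pos_apply hpos hodd, pderiv_eq_zero_of_notMem_vars, smul_zero]
    intro h
    have := hB (Finset.mem_coe.2 (Finset.mem_image_of_mem Subtype.val h))
    have := le_max_left B 0
    simp only at *
    omega
  · simp [twHeisOp_of_not_odd hodd]

lemma hasFiniteSupport_twNormalOrd (n : ℤ) (p : TwFockSpace) :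
    (fun i : ℤ => twNormalOrd i (2 * n - i) p).HasFiniteSupport := by
  obtain ⟨B, hB⟩ := exists_twHeisOp_eq_zero p
  refine (Set.finite_Icc (2 * n - B) B).subset fun i hi => ?_
  by_contra h
  refine hi ?_
  rw [Set.mem_Icc] at h
  have : B < max i (2 * n - i) := by omega
  simp [twNormalOrd, hB _ this]

/-- The twisted Sugawara operator as a linear endomorphism. -/
noncomputable def twSugawaraEnd (n : ℤ) : Module.End ℂ TwFockSpace where
  toFun := twSugawaraOp n
  map_add' p q := by
    simp only [twSugawaraOp, map_add]
    rw [finsum_add_distrib (hasFiniteSupport_twNormalOrd n p) (hasFiniteSupport_twNormalOrd n q)]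
    split_ifs
    · module
    · module
  map_smul' c p := by
    simp only [twSugawaraOp, map_smul, RingHom.id_apply]
    rw [← smul_finsum]
    split_ifs
    · module
    · module

lemma twSugawaraEnd_apply (n : ℤ) (p : TwFockSpace) :
    twSugawaraEnd n p = (2 : ℂ)⁻¹ • ∑ᶠ i : ℤ, twNormalOrd i (2 * n - i) p
      + (if n = 0 then ((16 : ℂ)⁻¹ • p) else 0) := rfl

lemma lie_mul_twHeisOp (i j k : ℤ) :
    ⁅twHeisOp i * twHeisOp j, twHeisOp k⁆
      = (if j = -k ∧ Odd j then (j : ℂ) / 2 else 0) • twHeisOp i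
        + (if i = -k ∧ Odd i then (i : ℂ) / 2 else 0) • twHeisOp j := by
  rw [Ring.lie_def, mul_assoc, twHeisOp_comm j k, mul_add, ← mul_assoc, twHeisOp_comm i k]
  simp only [add_mul, mul_smul_comm, mul_one, smul_mul_assoc, one_mul, mul_assoc]
  abel

lemma lie_twNormalOrd_twHeisOp (i j k : ℤ) :
    ⁅twNormalOrd i j, twHeisOp k⁆
      = (if j = -k ∧ Odd j then (j : ℂ) / 2 else 0) • twHeisOp i
        + (if i = -k ∧ Odd i then (i : ℂ) / 2 else 0) • twHeisOp j := by
  rw [twNormalOrd, lie_mul_twHeisOp]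
  rcases le_total i j with h | h
  · rw [min_eq_left h, max_eq_right h]
  · rw [min_eq_right h, max_eq_left h, add_comm]

lemma lie_twSugawaraEnd_twHeisOp (n k : ℤ) :
    ⁅twSugawaraEnd n, twHeisOp k⁆ = (-((k : ℂ) / 2)) • twHeisOp (k + 2 * n) := by
  by_cases hk : Odd k
  swap
  · have : ¬ Odd (k + 2 * n) := fun h => hk (by simpa using h.sub_even (even_two_mul n))
    simp [twHeisOp_of_not_odd hk, twHeisOp_of_not_odd this]
  refine LinearMap.ext fun p => ?_
  have hfin := hasFiniteSupport_twNormalOrd n p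
  have hterm (i : ℤ) : twNormalOrd i (2 * n - i) (twHeisOp k p)
      - twHeisOp k (twNormalOrd i (2 * n - i) p)
      = (if i = k + 2 * n then (-((k : ℂ) / 2)) • twHeisOp (k + 2 * n) p else 0)
        + (if i = -k then (-((k : ℂ) / 2)) • twHeisOp (k + 2 * n) p else 0) := by
    have h := LinearMap.congr_fun (lie_twNormalOrd_twHeisOp i (2 * n - i) k) p
    rw [Ring.lie_def] at h
    simp only [LinearMap.sub_apply, Module.End.mul_apply, LinearMap.add_apply,
      LinearMap.smul_apply] at h
    rw [h]
    congr 1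
    · by_cases hi : i = k + 2 * n
      · have h1 : 2 * n - i = -k := by omega
        rw [if_pos hi, h1, if_pos ⟨rfl, hk.neg⟩, hi]
        push_cast
        module
      · rw [if_neg hi, if_neg (by omega), zero_smul]
    · by_cases hi : i = -k
      · have h1 : 2 * n - i = k + 2 * n := by omega
        rw [if_pos hi, h1, if_pos ⟨hi, hi ▸ hk.neg⟩, hi]
        push_cast
        module
      · rw [if_neg hi, if_neg (by tauto), zero_smul]
  have hsum : ∑ᶠ i : ℤ, twNormalOrd i (2 * n - i) (twHeisOp k p)
      - twHeisOp k (∑ᶠ i : ℤ, twNormalOrd i (2 * n - i) p)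
      = (-(k : ℂ)) • twHeisOp (k + 2 * n) p := by
    rw [map_finsum _ hfin, ← finsum_sub_distrib (hasFiniteSupport_twNormalOrd n _)
      (hfin.subset fun i hi h => hi (by simp [h]))]
    simp only [hterm]
    rw [finsum_add_distrib, finsum_eq_single _ (k + 2 * n) (fun i hi => if_neg hi),
      finsum_eq_single _ (-k) (fun i hi => if_neg hi), if_pos rfl, if_pos rfl]
    · module
    · exact (Set.finite_singleton (k + 2 * n)).subset fun i hi => by
        by_contra h
        exact hi (if_neg h)
    · exact (Set.finite_singleton (-k)).subset fun i hi => by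
        by_contra h
        exact hi (if_neg h)
  rw [Ring.lie_def, LinearMap.sub_apply, Module.End.mul_apply, Module.End.mul_apply,
    twSugawaraEnd_apply, twSugawaraEnd_apply, map_add, map_smul, add_sub_add_comm, ← smul_sub,
    hsum]
  split_ifs <;> simp only [LinearMap.smul_apply, map_smul, map_zero] <;> module

/-- Schur's lemma for the Fock representation. -/
lemma eq_smul_one_of_lie_twHeisOp_eq_zero (D : Module.End ℂ TwFockSpace)
    (hD : ∀ k, ⁅D, twHeisOp k⁆ = 0) : D = constantCoeff (D 1) • (1 : Module.End ℂ TwFockSpace) := by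
  have hcomm (k : ℤ) (p : TwFockSpace) : D (twHeisOp k p) = twHeisOp k (D p) := by
    have h := LinearMap.congr_fun (hD k) p
    rwa [Ring.lie_def, LinearMap.sub_apply, LinearMap.zero_apply, sub_eq_zero] at h
  have hone : D 1 = C (constantCoeff (D 1)) := by
    ext m
    rw [coeff_C]
    split_ifs with hm
    · rw [← hm, constantCoeff_eq]
    obtain ⟨i, hi⟩ : ∃ i, m i ≠ 0 := by
      by_contra! h
      exact hm (Finsupp.ext fun i => (h i).symm)
    have h1 := hcomm i.1 1
    rw [twHeisOp_pos_one i.2.1, map_zero, twHeisOp_pos_apply i.2.1 i.2.2] at h1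
    have hi0 : (i.1 : ℂ) / 2 ≠ 0 := by
      have := i.2.1.ne'
      simpa using this
    have h2 := congrArg (coeff (m - Finsupp.single i 1))
      ((smul_eq_zero.1 h1.symm).resolve_left hi0)
    have hm' : m - Finsupp.single i 1 + Finsupp.single i 1 = m :=
      tsub_add_cancel_of_le (Finsupp.single_le_iff.2 (Nat.one_le_iff_ne_zero.2 hi))
    rw [coeff_pderiv, coeff_zero] at h2
    simp only [Subtype.coe_eta, hm'] at h2
    refine (mul_eq_zero.1 h2).resolve_right ?_
    exact Nat.cast_add_one_ne_zero _
  refine LinearMap.ext fun p => ?_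
  rw [LinearMap.smul_apply, Module.End.one_apply]
  induction p using MvPolynomial.induction_on with
  | C a =>
    rw [← mul_one (C a), ← smul_eq_C_mul, map_smul, smul_comm,
      smul_eq_C_mul (1 : TwFockSpace) (constantCoeff _), mul_one, ← hone]
  | add p q hp hq => rw [map_add, hp, hq, smul_add]
  | mul_X p i hp => rw [mul_comm, ← twHeisOp_neg_apply, hcomm, hp, map_smul]

/-- The defect of the Virasoro relation without central term. -/
noncomputable def virasoroDefect (n m : ℤ) : Module.End ℂ TwFockSpace :=
  ⁅twSugawaraEnd n, twSugawaraEnd m⁆ - ((n : ℂ) - m) • twSugawaraEnd (n + m)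

lemma lie_virasoroDefect_twHeisOp (n m k : ℤ) : ⁅virasoroDefect n m, twHeisOp k⁆ = 0 := by
  have e1 : k + 2 * m + 2 * n = k + 2 * (n + m) := by ring
  have e2 : k + 2 * n + 2 * m = k + 2 * (n + m) := by ring
  simp only [virasoroDefect, sub_lie, smul_lie_end, lie_lie, lie_smul_end,
    lie_twSugawaraEnd_twHeisOp, e1, e2]
  push_cast
  module

lemma virasoroDefect_eq_smul_one (n m : ℤ) :
    virasoroDefect n m = constantCoeff (virasoroDefect n m 1) • (1 : Module.End ℂ TwFockSpace) :=
  eq_smul_one_of_lie_twHeisOp_eq_zero _ (lie_virasoroDefect_twHeisOp n m)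

lemma virasoroDefect_swap (n m : ℤ) : virasoroDefect n m = -virasoroDefect m n := by
  rw [virasoroDefect, virasoroDefect, ← lie_skew, add_comm m n]
  module

lemma twNormalOrd_one_of_pos {i j : ℤ} (h : 0 < i + j) :
    twNormalOrd i j (1 : TwFockSpace) = 0 := by
  rw [twNormalOrd, Module.End.mul_apply, twHeisOp_pos_one (by omega), map_zero]

lemma constantCoeff_twNormalOrd_of_nonpos {i j : ℤ} (h : i + j ≤ 0) (p : TwFockSpace) :
    constantCoeff (twNormalOrd i j p) = 0 :=
  constantCoeff_twHeisOp_of_nonpos (by omega) _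

lemma twSugawaraEnd_one_of_pos {n : ℤ} (hn : 0 < n) :
    twSugawaraEnd n (1 : TwFockSpace) = 0 := by
  have h (i : ℤ) : twNormalOrd i (2 * n - i) (1 : TwFockSpace) = 0 :=
    twNormalOrd_one_of_pos (by omega)
  simp [twSugawaraEnd_apply, h, hn.ne']

lemma constantCoeff_twSugawaraEnd_of_nonpos {n : ℤ} (hn : n ≤ 0) (p : TwFockSpace) :
    constantCoeff (twSugawaraEnd n p) = if n = 0 then 16⁻¹ * constantCoeff p else 0 := by
  have h : constantCoeff (∑ᶠ i : ℤ, twNormalOrd i (2 * n - i) p) = 0 := by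
    rw [map_finsum _ (hasFiniteSupport_twNormalOrd n p)]
    exact finsum_eq_zero_of_forall_eq_zero fun i =>
      constantCoeff_twNormalOrd_of_nonpos (by omega) p
  rw [twSugawaraEnd_apply, map_add, constantCoeff_smul, h]
  split_ifs <;> simp

lemma twSugawaraEnd_zero_one :
    twSugawaraEnd 0 (1 : TwFockSpace) = (16 : ℂ)⁻¹ • 1 := by
  have h (i : ℤ) : twNormalOrd i (2 * 0 - i) (1 : TwFockSpace) = 0 := by
    rcases lt_trichotomy i 0 with hi | rfl | hi
    · rw [twNormalOrd, Module.End.mul_apply, twHeisOp_pos_one (by omega), map_zero]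
    · simp [twNormalOrd, twHeisOp_of_not_odd]
    · rw [twNormalOrd, Module.End.mul_apply, twHeisOp_pos_one (by omega), map_zero]
  rw [twSugawaraEnd_apply]
  simp only [h]
  simp

lemma virasoroDefect_zero_left (m : ℤ) : virasoroDefect 0 m = 0 := by
  have hc : constantCoeff (virasoroDefect 0 m 1) = 0 := by
    have hm : (m : ℂ) * constantCoeff (twSugawaraEnd m (1 : TwFockSpace)) = 0 := by
      rcases lt_trichotomy m 0 with h | rfl | h
      · rw [constantCoeff_twSugawaraEnd_of_nonpos h.le, if_neg h.ne, mul_zero]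
      · simp
      · rw [twSugawaraEnd_one_of_pos h, map_zero, mul_zero]
    simp only [virasoroDefect, Ring.lie_def, LinearMap.sub_apply, Module.End.mul_apply,
      LinearMap.smul_apply, twSugawaraEnd_zero_one, map_smul, map_sub, constantCoeff_smul,
      constantCoeff_twSugawaraEnd_of_nonpos le_rfl, zero_add, smul_eq_mul, if_true]
    push_cast
    linear_combination hm
  rw [virasoroDefect_eq_smul_one, hc, zero_smul]

lemma lie_twSugawaraEnd_zero (m : ℤ) :
    ⁅twSugawaraEnd 0, twSugawaraEnd m⁆ = (-(m : ℂ)) • twSugawaraEnd m := by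
  have h := sub_eq_zero.1 (virasoroDefect_zero_left m)
  simpa using h

lemma virasoroDefect_of_add_ne_zero {n m : ℤ} (h : n + m ≠ 0) : virasoroDefect n m = 0 := by
  have h0 : ⁅twSugawaraEnd 0, virasoroDefect n m⁆ = 0 := by
    rw [virasoroDefect_eq_smul_one, lie_smul_end, Ring.lie_def, mul_one, one_mul, sub_self, smul_zero]
  have h1 : ⁅twSugawaraEnd 0, virasoroDefect n m⁆
      = (-((n + m : ℤ) : ℂ)) • virasoroDefect n m := by
    rw [virasoroDefect, lie_sub, lie_smul_end, leibniz_lie, lie_twSugawaraEnd_zero,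
      lie_twSugawaraEnd_zero, lie_twSugawaraEnd_zero, smul_lie_end, lie_smul_end]
    push_cast
    module
  refine (smul_eq_zero.1 (h1.symm.trans h0)).resolve_left ?_
  exact neg_ne_zero.2 (Int.cast_ne_zero.2 h)

lemma constantCoeff_twHeisOp_neg_twHeisOp_one (y : ℤ) :
    constantCoeff (twHeisOp (-y) (twHeisOp y (1 : TwFockSpace)))
      = if y < 0 ∧ Odd y then -(y : ℂ) / 2 else 0 := by
  rcases lt_or_ge 0 y with hy | hy
  · rw [twHeisOp_pos_one hy, if_neg (by omega)]
    simp
  · have h := twHeisOp_comm_apply (-y) y 1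
    have h' := congrArg constantCoeff h
    rw [map_sub, constantCoeff_twHeisOp_of_nonpos hy, sub_zero, constantCoeff_smul,
      map_one constantCoeff] at h'
    rw [h']
    by_cases ho : Odd y
    · have : y < 0 := by obtain ⟨k, rfl⟩ := ho; omega
      simp [ho, this]
    · simp [ho]

lemma constantCoeff_twSugawaraEnd_twNormalOrd_one {n i j : ℤ} (hn : 0 < n)
    (hij : i + j = -(2 * n)) :
    constantCoeff (twSugawaraEnd n (twNormalOrd i j (1 : TwFockSpace)))
      = if (i < 0 ∧ j < 0) ∧ Odd i then (i : ℂ) * j / 4 else 0 := by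
  have ho : Odd j ↔ Odd i := by
    constructor <;> rintro ⟨k, hk⟩ <;> exact ⟨-n - k - 1, by omega⟩
  wlog hle : i ≤ j generalizing i j
  · have := this (i := j) (j := i) (by omega) ho.symm (by omega)
    rw [twNormalOrd, min_comm, max_comm, ← twNormalOrd, this, mul_comm (i : ℂ)]
    simp only [ho, and_comm]
  rw [twNormalOrd, min_eq_left hle, max_eq_right hle, Module.End.mul_apply]
  have h := LinearMap.congr_fun (lie_twSugawaraEnd_twHeisOp n i) (twHeisOp j 1)
  rw [Ring.lie_def, LinearMap.sub_apply, Module.End.mul_apply, Module.End.mul_apply,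
    LinearMap.smul_apply, show i + 2 * n = -j by omega] at h
  have h' := congrArg constantCoeff h
  rw [map_sub, constantCoeff_twHeisOp_of_nonpos (by omega), sub_zero, constantCoeff_smul,
    constantCoeff_twHeisOp_neg_twHeisOp_one] at h'
  have hi : i < 0 := by omega
  simp only [h', ho, hi, true_and, smul_eq_mul]
  split_ifs <;> ring

lemma sum_range_odd_mul (x : ℂ) (N : ℕ) :
    ∑ k ∈ Finset.range N, (2 * (k : ℂ) + 1) * (2 * x - (2 * k + 1))
      = 2 * x * N ^ 2 - N * (4 * N ^ 2 - 1) / 3 := by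
  induction N with
  | zero => simp
  | succ N ih =>
    rw [Finset.sum_range_succ, ih]
    push_cast
    ring

lemma constantCoeff_twSugawaraEnd_twSugawaraEnd_neg_one {n : ℤ} (hn : 0 < n) :
    constantCoeff (twSugawaraEnd n (twSugawaraEnd (-n) (1 : TwFockSpace)))
      = (2 * (n : ℂ) ^ 3 + n) / 24 := by
  have hfin := hasFiniteSupport_twNormalOrd (-n) 1
  have hterm (i : ℤ) :=
    constantCoeff_twSugawaraEnd_twNormalOrd_one (i := i) (j := 2 * -n - i) hn (by omega)
  rw [twSugawaraEnd_apply (-n), if_neg (by omega), add_zero, map_smul, constantCoeff_smul,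
    map_finsum _ hfin,
    map_finsum _ (hfin.subset fun i hi h => hi (by simpa using congrArg (twSugawaraEnd n) h))]
  simp only [hterm]
  obtain ⟨N, rfl⟩ := Int.eq_ofNat_of_zero_le hn.le
  have hinj : Function.Injective fun k : ℕ => -(2 * (k : ℤ) + 1) := fun a b h => by
    simp only at h
    omega
  rw [finsum_eq_sum_of_support_subset (s := (Finset.range N).image fun k : ℕ => -(2 * (k : ℤ) + 1)),
    Finset.sum_image hinj.injOn]
  · have hsum := sum_range_odd_mul N N
    have : ∀ k ∈ Finset.range N,
        (if (-(2 * (k : ℤ) + 1) < 0 ∧ 2 * -(N : ℤ) - -(2 * (k : ℤ) + 1) < 0)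
            ∧ Odd (-(2 * (k : ℤ) + 1)) then
          ((-(2 * (k : ℤ) + 1) : ℤ) : ℂ) * ((2 * -(N : ℤ) - -(2 * (k : ℤ) + 1) : ℤ) : ℂ) / 4
        else 0) = (2 * (k : ℂ) + 1) * (2 * N - (2 * k + 1)) / 4 := by
      intro k hk
      rw [Finset.mem_range] at hk
      rw [if_pos ⟨by omega, (odd_two_mul_add_one (k : ℤ)).neg⟩]
      push_cast
      ring
    rw [Finset.sum_congr rfl this, ← Finset.sum_div, hsum, smul_eq_mul]
    push_cast
    ring
  · intro i hi
    rw [Function.mem_support, ne_eq, ite_eq_right_iff, Classical.not_imp] at hi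
    obtain ⟨⟨⟨h1, h2⟩, k, hk⟩, -⟩ := hi
    rw [Finset.mem_coe, Finset.mem_image]
    refine ⟨(-k - 1).toNat, ?_, ?_⟩
    · rw [Finset.mem_range]
      omega
    · omega

lemma virasoroDefect_neg_of_pos {n : ℤ} (hn : 0 < n) :
    virasoroDefect n (-n) = (((n : ℂ) ^ 3 - n) / 12) • (1 : Module.End ℂ TwFockSpace) := by
  rw [virasoroDefect_eq_smul_one]
  congr 1
  rw [virasoroDefect, Ring.lie_def, LinearMap.sub_apply, LinearMap.sub_apply, LinearMap.smul_apply,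
    Module.End.mul_apply, Module.End.mul_apply, twSugawaraEnd_one_of_pos hn, map_zero, sub_zero,
    add_neg_cancel, twSugawaraEnd_zero_one, map_sub,
    constantCoeff_twSugawaraEnd_twSugawaraEnd_neg_one hn, constantCoeff_smul, constantCoeff_smul,
    map_one]
  simp only [smul_eq_mul]
  push_cast
  ring

lemma virasoroDefect_eq (n m : ℤ) :
    virasoroDefect n m
      = (if n = -m then ((n : ℂ) ^ 3 - n) / 12 else 0) • (1 : Module.End ℂ TwFockSpace) := by
  split_ifs with h
  · obtain rfl : m = -n := by omega
    rcases lt_trichotomy n 0 with hn | rfl | hn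
    · have h' := virasoroDefect_neg_of_pos (n := -n) (by omega)
      rw [neg_neg] at h'
      rw [virasoroDefect_swap, h']
      push_cast
      module
    · simp [virasoroDefect_zero_left]
    · exact virasoroDefect_neg_of_pos hn
  · rw [zero_smul, virasoroDefect_of_add_ne_zero (by omega)]

/-- **Virasoro commutation relations for the rank-one `h = 2` twisted Sugawara
construction:** `[Lₙ, Lₘ] = (n − m)·L_{n+m} + δ_{n,−m}·((n³ − n)/12)·id`. -/
theorem twisted_sugawara_virasoro_relations (n m : ℤ) (p : TwFockSpace) :
    twSugawaraOp n (twSugawaraOp m p) - twSugawaraOp m (twSugawaraOp n p)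
      = ((n : ℂ) - (m : ℂ)) • twSugawaraOp (n + m) p
        + (if n = -m then ((n : ℂ) ^ 3 - (n : ℂ)) / 12 else 0) • p := by
  have h := LinearMap.congr_fun (virasoroDefect_eq n m) p
  rw [virasoroDefect, Ring.lie_def, LinearMap.sub_apply, sub_eq_iff_eq_add'] at h
  exact h
end
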